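/- arXiv:1902.07962 — 4 statements merged into one kernel-verified Lean document; each statement's English description precedes it below -/
import Mathlib

section
/- The class 𝒢 is closed under finite products: if G_1, …, G_r are groups in 𝒢, then the direct product G_1 × ⋯ × G_r is in 𝒢. -/
universe u

/-- A (multiplicative) group is a direct sum of cyclic groups if it is isomorphic to
`Multiplicative` of a direct sum `⨁ i, ZMod (n i)` (recall `ZMod 0 = ℤ`). -/
def IsDirectSumOfCyclic (A : Type u) [Group A] : Prop :=
  ∃ (ι : Type u) (n : ι → ℕ),
    Nonempty (A ≃* Multiplicative (DirectSum ι fun i => ZMod (n i)))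

/-- The class `𝒢` of groups: every torsion subgroup is finite and every abelian subgroup is
a direct sum of cyclic groups. -/
def InClassG (G : Type u) [Group G] : Prop :=
  (∀ T : Subgroup G, (∀ x ∈ T, IsOfFinOrder x) → (T : Set G).Finite) ∧
  (∀ A : Subgroup G, (∀ x ∈ A, ∀ y ∈ A, x * y = y * x) → IsDirectSumOfCyclic A)

/-- A direct sum over a disjoint union is the product of the two direct sums. -/
noncomputable def DirectSum.prodAddEquivSum {ι κ : Type*} (β : ι ⊕ κ → Type*)
    [∀ x, AddCommMonoid (β x)] :
    (DirectSum ι fun i => β (Sum.inl i)) × (DirectSum κ fun k => β (Sum.inr k)) ≃+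
      DirectSum (ι ⊕ κ) β := by
  classical
  exact AddMonoidHom.toAddEquiv
    (AddMonoidHom.coprod
      (DirectSum.toAddMonoid fun i => DirectSum.of β (Sum.inl i))
      (DirectSum.toAddMonoid fun k => DirectSum.of β (Sum.inr k)))
    (DirectSum.toAddMonoid fun x => match x with
      | Sum.inl i => (AddMonoidHom.inl _ _).comp (DirectSum.of (fun i => β (Sum.inl i)) i)
      | Sum.inr k => (AddMonoidHom.inr _ _).comp (DirectSum.of (fun k => β (Sum.inr k)) k))
    (by
      refine (AddMonoidHom.coprod_unique _).symm.trans
        (Eq.trans ?_ (AddMonoidHom.coprod_unique _))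
      congr 1 <;> exact DirectSum.addHom_ext fun i y => by simp)
    (by
      refine DirectSum.addHom_ext fun x y => ?_
      rw [AddMonoidHom.comp_apply, DirectSum.toAddMonoid_of]
      cases x <;> simp)

/-- A surjection of an abelian group onto a free abelian group splits. -/
theorem DirectSum.exists_rightInverse_of_forall_eq_zero {M J : Type*} [AddCommGroup M]
    {m : J → ℕ} (hm : ∀ j, m j = 0) (f : M →+ DirectSum J fun j => ZMod (m j))
    (hf : Function.Surjective f) :
    ∃ s : (DirectSum J fun j => ZMod (m j)) →+ M, ∀ x, f (s x) = x := by
  classical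
  choose t ht using fun j : J => hf (DirectSum.of (fun j => ZMod (m j)) j 1)
  let s : (DirectSum J fun j => ZMod (m j)) →+ M :=
    DirectSum.toAddMonoid fun j => ZMod.lift (m j) ⟨zmultiplesHom M (t j), by simp [hm j]⟩
  have hs : f.comp s = AddMonoidHom.id _ := by
    refine DirectSum.addHom_ext fun j y => ?_
    obtain ⟨z, rfl⟩ := ZMod.intCast_surjective y
    simp only [s, AddMonoidHom.comp_apply, DirectSum.toAddMonoid_of, ZMod.lift_coe,
      zmultiplesHom_apply, map_zsmul, ht, AddMonoidHom.id_apply]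
    rw [← map_zsmul, zsmul_one]
  exact ⟨s, DFunLike.congr_fun hs⟩

theorem IsDirectSumOfCyclic.of_mulEquiv {A B : Type u} [Group A] [Group B] (e : A ≃* B)
    (hB : IsDirectSumOfCyclic B) : IsDirectSumOfCyclic A := by
  obtain ⟨ι, n, ⟨f⟩⟩ := hB
  exact ⟨ι, n, ⟨e.trans f⟩⟩

theorem IsDirectSumOfCyclic.of_finite (A : Type u) [CommGroup A] [Finite A] :
    IsDirectSumOfCyclic A := by
  obtain ⟨ι, _, n, -, ⟨e⟩⟩ := AddCommGroup.equiv_directSum_zmod_of_finite' (Additive A)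
  exact ⟨ULift.{u} ι, fun i => n i.down,
    ⟨(AddEquiv.toMultiplicativeRight
      (e.trans (DirectSum.equivCongrLeft Equiv.ulift.{u}.symm)))⟩⟩

/-- An extension of a free abelian group by a direct sum of cyclic groups, if commutative, is a
direct sum of cyclic groups. -/
theorem IsDirectSumOfCyclic.of_ker {K : Type u} [CommGroup K] {J : Type u} {m : J → ℕ}
    (hm : ∀ j, m j = 0) (f : K →* Multiplicative (DirectSum J fun j => ZMod (m j)))
    (hf : Function.Surjective f) (hker : IsDirectSumOfCyclic f.ker) :
    IsDirectSumOfCyclic K := by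
  obtain ⟨ι, n, ⟨e⟩⟩ := hker
  obtain ⟨s', hs'⟩ := DirectSum.exists_rightInverse_of_forall_eq_zero hm
    (MonoidHom.toAdditiveLeft f) hf
  let s : Multiplicative (DirectSum J fun j => ZMod (m j)) →* K :=
    AddMonoidHom.toMultiplicativeLeft s'
  have hs : ∀ x, f (s x) = x := hs'
  let g : K ≃* f.ker × Multiplicative (DirectSum J fun j => ZMod (m j)) :=
    { toFun := fun k => (⟨k * (s (f k))⁻¹, by
        rw [MonoidHom.mem_ker, map_mul, map_inv, hs, mul_inv_cancel]⟩, f k)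
      invFun := fun p => p.1 * s p.2
      left_inv := fun k => inv_mul_cancel_right k _
      right_inv := fun p => by
        have h : f (p.1 * s p.2) = p.2 := by
          rw [map_mul, hs, MonoidHom.mem_ker.mp p.1.2, one_mul]
        refine Prod.ext (Subtype.ext ?_) h
        simp only [h, mul_inv_cancel_right]
      map_mul' := fun a b => by
        refine Prod.ext (Subtype.ext ?_) (map_mul f a b)
        simp only [map_mul, mul_inv, Prod.fst_mul, Subgroup.coe_mul]
        exact mul_mul_mul_comm _ _ _ _ }
  exact ⟨ι ⊕ J, Sum.elim n m, ⟨g.trans ((e.prodCongr (MulEquiv.refl _)).trans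
    (MulEquiv.prodMultiplicative _ _ |>.symm.trans
      (AddEquiv.toMultiplicative
        (DirectSum.prodAddEquivSum fun x => ZMod (Sum.elim n m x)))))⟩⟩

/-- A direct sum of cyclic groups maps onto a free abelian group with torsion kernel. -/
theorem IsDirectSumOfCyclic.exists_surjective {B : Type u} [Group B]
    (hB : IsDirectSumOfCyclic B) :
    ∃ (J : Type u) (m : J → ℕ) (f : B →* Multiplicative (DirectSum J fun j => ZMod (m j))),
      (∀ j, m j = 0) ∧ Function.Surjective f ∧ ∀ x, f x = 1 → IsOfFinOrder x := by
  classical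
  obtain ⟨ι, n, ⟨e⟩⟩ := hB
  let p : (DirectSum ι fun i => ZMod (n i)) →+ DirectSum {i // n i = 0} fun j => ZMod (n j) :=
    DFinsupp.subtypeDomainAddMonoidHom _ fun i => n i = 0
  have hp : Function.Surjective p := by
    intro y
    induction y using DirectSum.induction_on with
    | zero => exact ⟨0, map_zero p⟩
    | of j y =>
      refine ⟨DirectSum.of (fun i => ZMod (n i)) j y, ?_⟩
      ext k
      change (DFinsupp.single (j : ι) y : Π₀ i, ZMod (n i)) k =
        (DFinsupp.single j y : Π₀ j : {i // n i = 0}, ZMod (n j)) k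
      by_cases h : j = k
      · subst h
        simp
      · rw [DFinsupp.single_eq_of_ne (Ne.symm h),
          DFinsupp.single_eq_of_ne fun h' => h (Subtype.ext h'.symm)]
    | add a b ha hb =>
      obtain ⟨a, rfl⟩ := ha
      obtain ⟨b, rfl⟩ := hb
      exact ⟨a + b, map_add p a b⟩
  have hker : ∀ x, p x = 0 → IsOfFinAddOrder x := by
    intro x hx
    rw [← DirectSum.sum_support_of x]
    refine sum_mem (S := AddCommMonoid.addTorsion _) fun i _ => ?_
    change IsOfFinAddOrder _
    by_cases hi : n i = 0
    · have : x i = 0 := DFunLike.congr_fun hx (⟨i, hi⟩ : {i // n i = 0})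
      rw [this, map_zero]
      exact IsOfFinAddOrder.zero
    · have : NeZero (n i) := ⟨hi⟩
      exact (DirectSum.of (fun i => ZMod (n i)) i).isOfFinAddOrder (isOfFinAddOrder_of_finite _)
  refine ⟨{i // n i = 0}, fun j => n j, (AddMonoidHom.toMultiplicative p).comp e.toMonoidHom,
    fun j => j.2, hp.comp e.surjective, fun x hx => ?_⟩
  have := hker (e x).toAdd hx
  rw [← isOfFinOrder_ofAdd_iff] at this
  exact (Function.Injective.isOfFinOrder_iff (f := e.toMonoidHom) e.injective).mp this

theorem isOfFinOrder_pi_of_forall {ι : Type*} [Finite ι] {G : ι → Type*} [∀ i, Group (G i)]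
    {x : ∀ i, G i} (hx : ∀ i, IsOfFinOrder (x i)) : IsOfFinOrder x := by
  cases nonempty_fintype ι
  refine isOfFinOrder_iff_pow_eq_one.mpr
    ⟨∏ i, orderOf (x i), Finset.prod_pos fun i _ => (hx i).orderOf_pos, funext fun i => ?_⟩
  exact orderOf_dvd_iff_pow_eq_one.mp (Finset.dvd_prod_of_mem _ (Finset.mem_univ i))

theorem isDirectSumOfCyclic_of_forall_notMem_isOfFinOrder {r : ℕ} {G : Fin r → Type u}
    [∀ i, Group (G i)] (hG : ∀ i, InClassG (G i))
    (hfin : ∀ T : Subgroup (∀ i, G i), (∀ x ∈ T, IsOfFinOrder x) → (T : Set (∀ i, G i)).Finite)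
    (s : Finset (Fin r)) (A : Subgroup (∀ i, G i)) (hA : ∀ x ∈ A, ∀ y ∈ A, x * y = y * x)
    (hs : ∀ i ∉ s, ∀ x ∈ A, IsOfFinOrder (x i)) : IsDirectSumOfCyclic A := by
  classical
  induction s using Finset.induction_on generalizing A with
  | empty =>
    have : Finite A := hfin A fun x hx => isOfFinOrder_pi_of_forall fun i => hs i (by simp) x hx
    let _ : CommGroup A :=
      { (inferInstance : Group A) with
        mul_comm := fun x y => Subtype.ext (hA x x.2 y y.2) }
    exact IsDirectSumOfCyclic.of_finite A
  | insert i s _ ih =>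
    let _ : CommGroup A :=
      { (inferInstance : Group A) with
        mul_comm := fun x y => Subtype.ext (hA x x.2 y y.2) }
    let π := Pi.evalMonoidHom G i
    have hB : IsDirectSumOfCyclic (A.map π) := by
      refine (hG i).2 _ ?_
      rintro _ ⟨x, hx, rfl⟩ _ ⟨y, hy, rfl⟩
      rw [← map_mul, hA x hx y hy, map_mul]
    obtain ⟨J, m, f, hm, hf, htor⟩ := hB.exists_surjective
    let g := f.comp (π.subgroupMap A)
    refine IsDirectSumOfCyclic.of_ker hm g (hf.comp (π.subgroupMap_surjective A)) ?_
    refine IsDirectSumOfCyclic.of_mulEquiv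
      (g.ker.equivMapOfInjective A.subtype A.subtype_injective) (ih _ ?_ ?_)
    · rintro _ ⟨x, _, rfl⟩ _ ⟨y, _, rfl⟩
      exact hA x x.2 y y.2
    · rintro j hj _ ⟨x, hx, rfl⟩
      by_cases hji : j = i
      · subst hji
        exact (A.map π).subtype.isOfFinOrder (htor _ hx)
      · exact hs j (by simp [hji, hj]) x x.2

/-- The class `𝒢` is closed under finite products. -/
theorem classG_finite_prod {r : ℕ} (G : Fin r → Type u) [∀ i, Group (G i)]
    (hG : ∀ i, InClassG (G i)) : InClassG (∀ i, G i) := by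
  have hfin : ∀ T : Subgroup (∀ i, G i), (∀ x ∈ T, IsOfFinOrder x) →
      (T : Set (∀ i, G i)).Finite := by
    intro T hT
    refine (Set.Finite.pi' (t := fun i => (T.map (Pi.evalMonoidHom G i) : Set (G i)))
      fun i => (hG i).1 _ ?_).subset fun x hx i => ⟨x, hx, rfl⟩
    rintro _ ⟨x, hx, rfl⟩
    exact (Pi.evalMonoidHom G i).isOfFinOrder (hT x hx)
  exact ⟨hfin, fun A hA => isDirectSumOfCyclic_of_forall_notMem_isOfFinOrder hG hfin Finset.univ A
    hA (by simp)⟩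
end

section
/- Every right-angled Artin group is torsion free: if Γ = (V, E) is a simplicial graph and A_Γ is the right-angled Artin group on Γ, then the only element of finite order in A_Γ is the identity. -/
/-- The right-angled Artin group on a simplicial graph `Γ`: the quotient of the free group
on the vertices by the normal closure of the commutators `[v, w]` for edges `{v, w}`. -/
abbrev RAAG {V : Type*} (Γ : SimpleGraph V) : Type _ :=
  FreeGroup V ⧸ Subgroup.normalClosure
    {x | ∃ v w : V, Γ.Adj v w ∧
      x = FreeGroup.of v * FreeGroup.of w * (FreeGroup.of v)⁻¹ * (FreeGroup.of w)⁻¹}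

/-- The action of a group on the free group over a set it acts on. -/
def FreeGroup.mulAutOfMulAction (G X : Type*) [Group G] [MulAction G X] :
    G →* MulAut (FreeGroup X) where
  toFun g := FreeGroup.freeGroupCongr (MulAction.toPerm g)
  map_one' := by
    ext x
    induction x using FreeGroup.induction_on <;> simp_all
  map_mul' g h := by
    ext x
    induction x using FreeGroup.induction_on <;> simp_all [mul_smul]

@[simp]
theorem FreeGroup.mulAutOfMulAction_of {G X : Type*} [Group G] [MulAction G X] (g : G) (x : X) :
    FreeGroup.mulAutOfMulAction G X g (FreeGroup.of x) = FreeGroup.of (g • x) := by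
  simp [FreeGroup.mulAutOfMulAction]

namespace Subgroup

variable {A : Type*} [Group A] (G : Subgroup A) (v : A)

/-- The semidirect product of a subgroup `G` with the free group on the cosets in `G` of the
centralizer of an element `v`. These cosets correspond to the `G`-conjugates of `v`. -/
abbrev FreeConjugates : Type _ :=
  FreeGroup (G ⧸ (centralizer {v}).subgroupOf G) ⋊[FreeGroup.mulAutOfMulAction G
    (G ⧸ (centralizer {v}).subgroupOf G)] G

/-- The conjugate of `v` corresponding to a coset of the centralizer of `v`. -/
def conjOfCoset : G ⧸ (centralizer {v}).subgroupOf G → A :=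
  Quotient.lift (fun g : G => (g : A) * v * (g : A)⁻¹) <| by
    intro a b hab
    have h : a⁻¹ * b ∈ (centralizer {v}).subgroupOf G := QuotientGroup.leftRel_apply.mp hab
    rw [mem_subgroupOf, mem_centralizer_singleton_iff] at h
    have h' : (a : A)⁻¹ * b * v = v * ((a : A)⁻¹ * b) := by simpa using h
    change (a : A) * v * (a : A)⁻¹ = b * v * (b : A)⁻¹
    calc (a : A) * v * (a : A)⁻¹ = a * (v * ((a : A)⁻¹ * b)) * (b : A)⁻¹ := by group
      _ = b * v * (b : A)⁻¹ := by rw [← h']; group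

theorem conjOfCoset_mk (g : G) : conjOfCoset G v (g : G ⧸ _) = g * v * (g : A)⁻¹ := rfl

/-- The homomorphism evaluating formal conjugates of `v` in the ambient group. -/
def FreeConjugates.eval : FreeConjugates G v →* A :=
  SemidirectProduct.lift (FreeGroup.lift (conjOfCoset G v)) G.subtype <| by
    intro g
    ext x
    induction x using QuotientGroup.induction_on with
    | H x =>
      simp only [MonoidHom.comp_apply, MulEquiv.coe_toMonoidHom,
        FreeGroup.mulAutOfMulAction_of, FreeGroup.lift_apply_of, MulAut.conj_apply,
        MulAction.Quotient.smul_coe, conjOfCoset_mk]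
      simp [mul_assoc]

theorem FreeConjugates.eq_one_of_isOfFinOrder (hG : ∀ g ∈ G, IsOfFinOrder g → g = 1)
    {x : FreeConjugates G v} (hx : IsOfFinOrder x) : x = 1 := by
  have hr : x.right = 1 := by
    have h := (G.subtype.comp SemidirectProduct.rightHom).isOfFinOrder hx
    exact Subtype.ext (hG _ x.right.2 h)
  have hl : x = SemidirectProduct.inl x.left := SemidirectProduct.ext rfl hr
  rw [hl] at hx ⊢
  rw [((SemidirectProduct.inl_injective).isOfFinOrder_iff.mp hx).eq_one', map_one]

end Subgroup

namespace RAAG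

variable {V : Type*} {Γ : SimpleGraph V}

/-- The generator of a right-angled Artin group corresponding to a vertex. -/
def of (Γ : SimpleGraph V) (v : V) : RAAG Γ := QuotientGroup.mk (FreeGroup.of v)

theorem commute_of {v w : V} (h : Γ.Adj v w) : Commute (of Γ v) (of Γ w) := by
  rw [← commutatorElement_eq_one_iff_commute]
  exact (QuotientGroup.eq_one_iff _).mpr (Subgroup.subset_normalClosure ⟨v, w, h, rfl⟩)

/-- A map from the vertices to a group, taking adjacent vertices to commuting elements, extends to
the right-angled Artin group. -/
def lift {B : Type*} [Group B] (f : V → B) (hf : ∀ v w, Γ.Adj v w → Commute (f v) (f w)) :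
    RAAG Γ →* B :=
  QuotientGroup.lift _ (FreeGroup.lift f) <| by
    intro x hx
    refine Subgroup.normalClosure_le_normal (N := (FreeGroup.lift f).ker) ?_ hx
    rintro _ ⟨v, w, h, rfl⟩
    simpa [MonoidHom.mem_ker, commutatorElement_def] using
      commutatorElement_eq_one_iff_commute.mpr (hf v w h)

@[simp]
theorem lift_of {B : Type*} [Group B] (f : V → B)
    (hf : ∀ v w, Γ.Adj v w → Commute (f v) (f w)) (v : V) : lift f hf (of Γ v) = f v :=
  FreeGroup.lift_apply_of

theorem closure_range_of : Subgroup.closure (Set.range (of Γ)) = ⊤ := by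
  have h := congrArg (Subgroup.map (QuotientGroup.mk' (Subgroup.normalClosure
    {x | ∃ v w : V, Γ.Adj v w ∧
      x = FreeGroup.of v * FreeGroup.of w * (FreeGroup.of v)⁻¹ * (FreeGroup.of w)⁻¹})))
    (FreeGroup.closure_range_of V)
  rw [MonoidHom.map_closure, ← Set.range_comp,
    Subgroup.map_top_of_surjective _ (QuotientGroup.mk'_surjective _)] at h
  exact h

theorem exists_finset_mem_closure (x : RAAG Γ) :
    ∃ S : Finset V, x ∈ Subgroup.closure (of Γ '' S) := by
  classical
  have hx : x ∈ Subgroup.closure (Set.range (of Γ)) := closure_range_of ▸ Subgroup.mem_top x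
  induction hx using Subgroup.closure_induction with
  | mem x hx =>
    obtain ⟨v, rfl⟩ := hx
    exact ⟨{v}, Subgroup.subset_closure ⟨v, by simp, rfl⟩⟩
  | one => exact ⟨∅, one_mem _⟩
  | mul x y _ _ hx hy =>
    obtain ⟨S, hS⟩ := hx
    obtain ⟨T, hT⟩ := hy
    exact ⟨S ∪ T, mul_mem
      (Subgroup.closure_mono (Set.image_mono (by simp)) hS)
      (Subgroup.closure_mono (Set.image_mono (by simp)) hT)⟩
  | inv x _ hx =>
    obtain ⟨S, hS⟩ := hx
    exact ⟨S, inv_mem hS⟩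

open Classical in
/-- The image of a vertex under the homomorphism exhibiting the subgroup generated by
`insert v S` as a semidirect product. -/
noncomputable def splitVertex (Γ : SimpleGraph V) (S : Set V) (v u : V) :
    (Subgroup.closure (of Γ '' S)).FreeConjugates (of Γ v) :=
  if h : u ∈ S then
    SemidirectProduct.inr ⟨of Γ u, Subgroup.subset_closure (Set.mem_image_of_mem _ h)⟩
  else if u = v then
    SemidirectProduct.inl (FreeGroup.of ((1 : Subgroup.closure (of Γ '' S)) : _ ⧸ _))
  else 1

theorem commute_splitVertex (Γ : SimpleGraph V) (S : Set V) {v : V} (hv : v ∉ S)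
    (u w : V) (h : Γ.Adj u w) :
    Commute (splitVertex Γ S v u) (splitVertex Γ S v w) := by
  have key : ∀ w, Γ.Adj v w → Commute (splitVertex Γ S v v) (splitVertex Γ S v w) := by
    intro w h
    by_cases hw : w ∈ S
    · simp only [splitVertex, hv, hw, dite_true, dite_false, if_true]
      refine Commute.symm ?_
      rw [Commute, SemiconjBy, ← mul_inv_eq_iff_eq_mul, ← map_inv, ← SemidirectProduct.inl_aut,
        FreeGroup.mulAutOfMulAction_of]
      congr 2
      rw [MulAction.Quotient.smul_coe, QuotientGroup.eq]
      simpa [Subgroup.mem_subgroupOf, Subgroup.mem_centralizer_singleton_iff] using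
        (commute_of h).symm.eq
    · simp [splitVertex, hw, h.ne']
  by_cases huv : u = v
  · exact huv ▸ key w (huv ▸ h)
  by_cases hwv : w = v
  · exact hwv ▸ (key u (hwv ▸ h.symm)).symm
  by_cases hu : u ∈ S
  · by_cases hw : w ∈ S
    · simp only [splitVertex, hu, hw, dite_true]
      refine Commute.map (Subtype.ext ?_) _
      exact (commute_of h).eq
    · simp [splitVertex, hw, hwv]
  · simp [splitVertex, hu, huv]

theorem eq_one_of_mem_closure_of_isOfFinOrder (S : Finset V) :
    ∀ x ∈ Subgroup.closure (of Γ '' S), IsOfFinOrder x → x = 1 := by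
  classical
  induction S using Finset.induction_on with
  | empty => simp
  | insert v S hv ih =>
    intro x hx hfin
    have hv' : v ∉ (S : Set V) := by simpa using hv
    let f : RAAG Γ →* (Subgroup.closure (of Γ '' (S : Set V))).FreeConjugates (of Γ v) :=
      lift (splitVertex Γ (S : Set V) v) (commute_splitVertex Γ (S : Set V) hv')
    have hL : Set.EqOn ((Subgroup.FreeConjugates.eval
        (Subgroup.closure (of Γ '' S)) (of Γ v)).comp f) (MonoidHom.id (RAAG Γ))
        (of Γ '' (insert v S : Finset V)) := by
      rintro _ ⟨u, hu, rfl⟩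
      by_cases huS : u ∈ S
      · simp [f, splitVertex, huS, Subgroup.FreeConjugates.eval]
      · obtain rfl : u = v := by simpa [huS] using hu
        simp [f, splitVertex, huS, Subgroup.FreeConjugates.eval, Subgroup.conjOfCoset_mk]
    have hx' := MonoidHom.eqOn_closure hL hx
    have hf : f x = 1 := Subgroup.FreeConjugates.eq_one_of_isOfFinOrder _ _ ih (f.isOfFinOrder hfin)
    simpa [hf] using hx'.symm

end RAAG

/-- Every right-angled Artin group is torsion free. -/
theorem RAAG_torsion_free {V : Type*} (Γ : SimpleGraph V) (x : RAAG Γ)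
    (hx : IsOfFinOrder x) : x = 1 := by
  obtain ⟨S, hS⟩ := RAAG.exists_finset_mem_closure x
  exact RAAG.eq_one_of_mem_closure_of_isOfFinOrder S x hS hx
end

section
/- Let W be a Coxeter group with a finite generating set, i.e. the group of a Coxeter system (W, S) with S finite. Then every torsion subgroup of W is finite. -/
section Minkowski

variable {R : Type*} [Ring R]

theorem exists_pow_eq_one_add_three_mul (x : R) (i : ℕ) :
    ∃ y, (1 + 3 * x) ^ i = 1 + 3 * y := by
  induction i with
  | zero => exact ⟨0, by simp⟩
  | succ i ih =>
    obtain ⟨y, hy⟩ := ih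
    refine ⟨y + x + 3 * (y * x), ?_⟩
    have h3 : y * 3 = 3 * y := (Nat.cast_commute 3 y).symm.eq
    rw [pow_succ, hy]
    calc (1 + 3 * y) * (1 + 3 * x) = 1 + 3 * y + 3 * x + 3 * (y * 3) * x := by noncomm_ring
      _ = _ := by rw [h3]; noncomm_ring

theorem exists_geom_sum_eq_add_three_mul (x : R) (p : ℕ) :
    ∃ y, ∑ i ∈ Finset.range p, (1 + 3 * x) ^ i = p + 3 * y := by
  choose y hy using exists_pow_eq_one_add_three_mul x
  exact ⟨∑ i ∈ Finset.range p, y i, by simp [hy, Finset.sum_add_distrib, Finset.mul_sum]⟩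

/-- If `1 + 3 * x` has prime order in a ring without `3`-torsion, then `3 * x` is divisible by all
powers of `3`. -/
theorem exists_three_mul_eq_of_pow_prime_eq_one (h3 : ∀ r : R, 3 * r = 0 → r = 0) {p : ℕ}
    (hp : p.Prime) {x : R} (hx : (1 + 3 * x) ^ p = 1) : ∃ c, 3 * x = 3 * (3 * x * c) := by
  have hgeom := mul_geom_sum (1 + 3 * x) p
  rw [hx, sub_self, add_sub_cancel_left] at hgeom
  have hcomm (r : R) : r * 3 = 3 * r := (Nat.cast_commute 3 r).symm.eq
  by_cases hp3 : p = 3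
  · subst hp3
    refine ⟨-(x + x * x), ?_⟩
    have key : 3 * (3 * (x + 3 * (x * (x + x * x)))) = 0 := by
      rw [← hgeom]
      simp only [Finset.sum_range_succ, Finset.sum_range_zero, pow_zero, pow_succ, one_mul]
      have e : x * (3 * x) = 3 * (x * x) := by rw [← mul_assoc, hcomm, mul_assoc]
      have e' : 3 * x * (3 * x) = 9 * (x * x) := by
        rw [mul_assoc, e]; noncomm_ring
      have e'' : 3 * x * (9 * (x * x)) = 27 * (x * x * x) := by
        have : x * 9 = 9 * x := (Nat.cast_commute 9 x).symm.eq
        rw [mul_assoc, ← mul_assoc x, this]; noncomm_ring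
      calc _ = 9 * x + 27 * (x * x) + 27 * (x * x * x) := by noncomm_ring
        _ = 3 * x + 3 * x + 3 * x + 3 * x * (3 * x) + 3 * x * (3 * x) + 3 * x * (3 * x)
            + 3 * x * (9 * (x * x)) := by rw [e', e'']; noncomm_ring
        _ = _ := by rw [← e']; noncomm_ring
    have := h3 _ (h3 _ key)
    calc 3 * x = 3 * (x + 3 * (x * (x + x * x))) - 3 * (3 * x * (x + x * x)) := by noncomm_ring
      _ = _ := by rw [this]; noncomm_ring
  · obtain ⟨y, hy⟩ := exists_geom_sum_eq_add_three_mul x p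
    rw [hy] at hgeom
    have hcop : IsCoprime (p : ℤ) 3 :=
      Nat.isCoprime_iff_coprime.mpr ((Nat.coprime_primes hp Nat.prime_three).mpr hp3)
    obtain ⟨u, v, huv⟩ := hcop
    have huv' : (p : R) * u + 3 * v = 1 := by
      have := congr_arg (Int.cast : ℤ → R) huv
      push_cast at this
      rw [← this, (Nat.cast_commute p (u : R)).eq, hcomm]
    refine ⟨v - y * u, ?_⟩
    calc 3 * x = 3 * x * (p * u + 3 * v) := by rw [huv', mul_one]
      _ = 3 * x * (p + 3 * y) * u + 3 * x * 3 * (v - y * u) := by noncomm_ring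
      _ = _ := by rw [hgeom, hcomm (3 * x)]; noncomm_ring

theorem Matrix.three_mul_apply {n : Type*} [Fintype n] [DecidableEq n] (r : Matrix n n ℤ)
    (i j : n) : ((3 : Matrix n n ℤ) * r) i j = 3 * r i j := by
  have h : (3 : Matrix n n ℤ) * r = (3 : ℤ) • r := by simp
  rw [h]
  simp

/-- **Minkowski's lemma**, for elements of prime order. -/
theorem Matrix.eq_zero_of_one_add_three_mul_pow_prime_eq_one {n : Type*} [Fintype n]
    [DecidableEq n] {p : ℕ} (hp : p.Prime) {x : Matrix n n ℤ} (hx : (1 + 3 * x) ^ p = 1) :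
    x = 0 := by
  have h3 (r : Matrix n n ℤ) (hr : 3 * r = 0) : r = 0 := by
    ext i j
    have := congr_fun₂ hr i j
    rw [three_mul_apply] at this
    simpa using this
  obtain ⟨c, hc⟩ := exists_three_mul_eq_of_pow_prime_eq_one h3 hp hx
  have hdvd (a : ℕ) : ∀ i j, (3 : ℤ) ^ a ∣ ((3 : Matrix n n ℤ) * x) i j := by
    induction a with
    | zero => simp
    | succ a ih =>
      intro i j
      rw [hc, three_mul_apply, pow_succ']
      exact mul_dvd_mul_left 3 (Finset.dvd_sum fun k _ ↦ (ih i k).mul_right _)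
  refine h3 x (Matrix.ext fun i j ↦ ?_)
  by_contra hne
  obtain ⟨a, ha⟩ := (Int.finiteMultiplicity_iff.mpr
    (⟨by decide, hne⟩ : Int.natAbs 3 ≠ 1 ∧ ((3 : Matrix n n ℤ) * x) i j ≠ 0))
  exact ha (hdvd (a + 1) i j)

/-- The kernel of reduction modulo `3` on integral matrices has no torsion. -/
theorem Matrix.eq_one_of_isOfFinOrder_of_map_eq_one {n : Type*} [Fintype n] [DecidableEq n]
    {g : Matrix n n ℤ} (hg : IsOfFinOrder g)
    (h : (Int.castRingHom (ZMod 3)).mapMatrix g = 1) : g = 1 := by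
  by_contra hne
  have hord : orderOf g ≠ 1 := mt orderOf_eq_one_iff.mp hne
  set p := (orderOf g).minFac
  have hp : p.Prime := Nat.minFac_prime hord
  set k := g ^ (orderOf g / p) with hk
  have hkp : orderOf k = p := orderOf_pow_orderOf_div hg.orderOf_pos.ne' (Nat.minFac_dvd _)
  have hmap : (Int.castRingHom (ZMod 3)).mapMatrix k = 1 := by rw [hk, map_pow, h, one_pow]
  have hdvd (i j : n) : (3 : ℤ) ∣ (k - 1) i j := by
    rw [show (3 : ℤ) = ((3 : ℕ) : ℤ) from rfl, ← ZMod.intCast_zmod_eq_zero_iff_dvd]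
    have : (Int.castRingHom (ZMod 3)).mapMatrix (k - 1) = 0 := by
      rw [map_sub, hmap, map_one, sub_self]
    exact congr_fun₂ this i j
  choose x hx using hdvd
  have hkx : k = 1 + 3 * Matrix.of x := by
    rw [← sub_eq_iff_eq_add']
    ext i j
    rw [three_mul_apply, hx, Matrix.of_apply]
  have h0 := eq_zero_of_one_add_three_mul_pow_prime_eq_one hp
    (x := Matrix.of x) (by rw [← hkx, ← hkp, pow_orderOf_eq_one])
  rw [h0, mul_zero, add_zero] at hkx
  rw [hkx, orderOf_one] at hkp
  exact hp.one_lt.ne hkp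

/-- Torsion subgroups of integral linear groups are finite. -/
theorem Subgroup.finite_of_torsion_of_injective_matrix {G : Type*} [Group G] {n : Type*}
    [Fintype n] [DecidableEq n] (φ : G →* Matrix n n ℤ) (hφ : Function.Injective φ)
    (T : Subgroup G) (hT : ∀ x ∈ T, IsOfFinOrder x) : (T : Set G).Finite := by
  let ψ : G →* Matrix n n (ZMod 3) :=
    ((Int.castRingHom (ZMod 3)).mapMatrix (m := n)).toMonoidHom.comp φ
  refine Set.Finite.of_injOn (f := ψ) (Set.mapsTo_univ _ _) ?_ Set.finite_univ
  intro x hx y hy hxy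
  have h1 : ψ (x⁻¹ * y) = 1 := by rw [map_mul, ← hxy, ← map_mul, inv_mul_cancel, map_one]
  have := Matrix.eq_one_of_isOfFinOrder_of_map_eq_one
    (φ.isOfFinOrder (hT _ (T.mul_mem (T.inv_mem hx) hy))) h1
  exact inv_mul_eq_one.mp (hφ (this.trans (map_one φ).symm))

end Minkowski

section Faithful

open Polynomial.Chebyshev CoxeterSystem

/-- If `w` does not have `s` as a right descent, an alternating suffix of a reduced
expression of `w` in the letters `s, t` is shorter than the braid word. -/
theorem lt_of_length_mul_wordProd_alternatingWord {B W : Type*} [Group W]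
    {M : CoxeterMatrix B} (cs : CoxeterSystem M W) {s t : B} {w v : W} {k : ℕ}
    (hs : ¬cs.IsRightDescent w s) (hw : w = v * cs.wordProd (alternatingWord s t k))
    (hl : cs.length w = cs.length v + k) (hM : M s t ≠ 0) : k < M s t := by
  have hred : cs.IsReduced (alternatingWord s t k) := by
    have h1 := cs.length_mul_le v (cs.wordProd (alternatingWord s t k))
    have h2 := cs.length_wordProd_le (alternatingWord s t k)
    rw [← hw] at h1
    rw [length_alternatingWord] at h2
    rw [CoxeterSystem.IsReduced, length_alternatingWord]
    lia
  by_contra! hk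
  obtain rfl : k = M s t :=
    le_antisymm (not_lt.mp fun h ↦ cs.not_isReduced_alternatingWord s t hM h hred) hk
  have hbraid := cs.wordProd_braidWord_eq s t
  obtain ⟨m, hm⟩ := Nat.exists_eq_succ_of_ne_zero hM
  rw [braidWord, braidWord, M.symmetric t s, hm, alternatingWord_succ t s,
    cs.wordProd_concat] at hbraid
  apply hs
  rw [IsRightDescent, hl, hw, hm, hbraid, mul_assoc, cs.simple_mul_simple_cancel_right]
  have h1 := cs.length_mul_le v (cs.wordProd (alternatingWord s t m))
  have h2 := cs.length_wordProd_le (alternatingWord s t m)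
  rw [length_alternatingWord] at h2
  lia

variable {B W R : Type*} [Fintype B] [DecidableEq B] [Group W] {M : CoxeterMatrix B}
  (cs : CoxeterSystem M W) [CommRing R] {C : Matrix B B R}
  {ρ : W →* ((B → R) ≃ₗ[R] (B → R))}

theorem apply_wordProd_alternatingWord_single
    (hρ : ∀ s v, ρ (cs.simple s) v = v - (C.mulVec v) s • Pi.single s 1)
    (hC2 : ∀ s, C s s = 2) (hC : ∀ s t, C s t = C t s) (s t : B) (k : ℕ) :
    ρ (cs.wordProd (alternatingWord s t k)) (Pi.single s 1) =
      (S R k).eval (-C s t) • Pi.single (if Even k then s else t) 1 +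
      (S R (k - 1)).eval (-C s t) • Pi.single (if Even k then t else s) 1 := by
  induction k with
  | zero => simp [alternatingWord]
  | succ k ih =>
    have hS : (S R ((k + 1 : ℕ) : ℤ)).eval (-C s t) =
        -C s t * (S R k).eval (-C s t) - (S R (k - 1)).eval (-C s t) := by
      simp [S_add_one]
    rw [alternatingWord_succ', cs.wordProd_cons, map_mul, LinearEquiv.mul_apply, ih, hρ, hS]
    by_cases hk : Even k
    · have hk' : ¬Even (k + 1) := by simp [hk, parity_simps]
      simp only [hk, hk', if_true, if_false, Matrix.mulVec_add, Matrix.mulVec_smul,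
        Matrix.mulVec_single_one, Pi.add_apply, Pi.smul_apply, Matrix.col_apply, hC2, smul_eq_mul,
        hC t s, Nat.cast_add, Nat.cast_one, add_sub_cancel_right]
      module
    · have hk' : Even (k + 1) := by simp [hk, parity_simps]
      simp only [hk, hk', if_true, if_false, Matrix.mulVec_add, Matrix.mulVec_smul,
        Matrix.mulVec_single_one, Pi.add_apply, Pi.smul_apply, Matrix.col_apply, hC2, smul_eq_mul,
        Nat.cast_add, Nat.cast_one, add_sub_cancel_right]
      module

variable [LinearOrder R] [IsStrictOrderedRing R]

theorem apply_single_nonneg_of_not_isRightDescent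
    (hρ : ∀ s v, ρ (cs.simple s) v = v - (C.mulVec v) s • Pi.single s 1)
    (hC2 : ∀ s, C s s = 2) (hC : ∀ s t, C s t = C t s)
    (hpos : ∀ s t, ∀ k : ℕ, M s t = 0 ∨ k < M s t → 0 ≤ (S R k).eval (-C s t))
    (w : W) (s : B) (hs : ¬cs.IsRightDescent w s) : 0 ≤ ρ w (Pi.single s 1) := by
  induction hn : cs.length w using Nat.strong_induction_on generalizing w s with
  | _ n IH =>
  subst hn
  rcases eq_or_ne w 1 with rfl | hw1
  · simp
  obtain ⟨t, ht⟩ := cs.exists_rightDescent_of_ne_one hw1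
  suffices key : ∀ l k (v : W), 1 ≤ k → cs.length v = l →
      w = v * cs.wordProd (alternatingWord s t k) → cs.length w = cs.length v + k →
      0 ≤ ρ w (Pi.single s 1) by
    refine key _ 1 (w * cs.simple t) le_rfl rfl ?_ ?_
    · simp [alternatingWord]
    · exact ((cs.isRightDescent_iff).mp ht).symm
  intro l
  induction l using Nat.strong_induction_on with
  | _ l ih =>
  intro k v hk hvl hwv hl
  obtain ⟨j, rfl⟩ : ∃ j, k = j + 1 := ⟨k - 1, by lia⟩
  by_cases hy : cs.IsRightDescent v (if Even (j + 1) then t else s)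
  · have hd := cs.isRightDescent_iff.mp hy
    refine ih _ (by lia) (j + 1 + 1) (v * cs.simple (if Even (j + 1) then t else s)) (by lia)
      rfl ?_ (by lia)
    rw [alternatingWord_succ' s t (j + 1), cs.wordProd_cons, ← mul_assoc,
      cs.simple_mul_simple_cancel_right, hwv]
  have hx : ¬cs.IsRightDescent v (if Even j then t else s) := by
    intro hx
    have hd := cs.isRightDescent_iff.mp hx
    rw [alternatingWord_succ', cs.wordProd_cons, ← mul_assoc] at hwv
    have h1 := cs.length_mul_le (v * cs.simple (if Even j then t else s))
      (cs.wordProd (alternatingWord s t j))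
    have h2 := cs.length_wordProd_le (alternatingWord s t j)
    rw [length_alternatingWord] at h2
    rw [← hwv] at h1
    lia
  have hlt : M s t = 0 ∨ j + 1 < M s t := by
    by_cases hM : M s t = 0
    · exact .inl hM
    · exact .inr (lt_of_length_mul_wordProd_alternatingWord cs hs hwv hl hM)
  rw [hwv, map_mul, LinearEquiv.mul_apply, apply_wordProd_alternatingWord_single cs hρ hC2 hC,
    map_add, map_smul, map_smul]
  have e : (if Even (j + 1) then s else t) = if Even j then t else s := by
    by_cases hj : Even j <;> simp [hj, parity_simps]
  have hS' : ((j + 1 : ℕ) : ℤ) - 1 = (j : ℕ) := by simp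
  rw [e, hS']
  exact add_nonneg
    (smul_nonneg (hpos s t _ hlt) (IH _ (by lia) v _ hx rfl))
    (smul_nonneg (hpos s t j (hlt.imp_right (by lia))) (IH _ (by lia) v _ hy rfl))

/-- Faithfulness of the geometric representation. -/
theorem injective_of_apply_simple
    (hρ : ∀ s v, ρ (cs.simple s) v = v - (C.mulVec v) s • Pi.single s 1)
    (hC2 : ∀ s, C s s = 2) (hC : ∀ s t, C s t = C t s)
    (hpos : ∀ s t, ∀ k : ℕ, M s t = 0 ∨ k < M s t → 0 ≤ (S R k).eval (-C s t)) :
    Function.Injective ρ := by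
  rw [injective_iff_map_eq_one]
  intro w hw
  by_contra hw1
  obtain ⟨s, hs⟩ := cs.exists_rightDescent_of_ne_one hw1
  have h := apply_single_nonneg_of_not_isRightDescent cs hρ hC2 hC hpos (w * cs.simple s) s
    (cs.isRightDescent_iff_not_isRightDescent_mul.mp hs) s
  rw [map_mul, hw, one_mul, hρ] at h
  simp only [Matrix.mulVec_single_one, Matrix.col_apply, hC2, Pi.zero_apply, Pi.sub_apply,
    Pi.smul_apply, Pi.single_eq_same, smul_eq_mul, mul_one] at h
  linarith

end Faithful

section Trigonometry

open Polynomial.Chebyshev Real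

theorem S_eval_two_mul_cos_pi_div_nonneg {m k : ℕ} (h : m = 0 ∨ k < m) :
    0 ≤ (S ℝ k).eval (2 * cos (π / m)) := by
  rcases Nat.eq_zero_or_pos m with rfl | hm
  · simp only [CharP.cast_eq_zero, div_zero, cos_zero, mul_one, S_eval_two]
    positivity
  have hk : k < m := h.resolve_left hm.ne'
  rcases Nat.eq_or_lt_of_le hm with rfl | hm1
  · obtain rfl : k = 0 := by lia
    simp
  have hm0 : (0 : ℝ) < m := by exact_mod_cast hm
  have hsin : 0 < sin (π / m) :=
    sin_pos_of_pos_of_lt_pi (by positivity) (div_lt_self pi_pos (by exact_mod_cast hm1))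
  refine nonneg_of_mul_nonneg_left ?_ hsin
  rw [S_two_mul_real_cos]
  refine sin_nonneg_of_nonneg_of_le_pi (by positivity) ?_
  rw [mul_div_assoc', div_le_iff₀ hm0, mul_comm π]
  gcongr
  exact_mod_cast hk

theorem sin_two_pi_div_ne_zero {m : ℕ} (hm : 3 ≤ m) : sin (2 * π / m) ≠ 0 := by
  have hm' : (3 : ℝ) ≤ m := by exact_mod_cast hm
  refine (sin_pos_of_pos_of_lt_pi (by positivity) ?_).ne'
  rw [div_lt_iff₀ (by linarith)]
  nlinarith [pi_pos]

theorem S_eval_two_mul_cos_mul_eq_zero {m : ℕ} (hm : 3 ≤ m) :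
    (S ℝ ((m - 2) / 2)).eval (2 * cos (2 * π / m)) *
      ((S ℝ ((m - 1) / 2)).eval (2 * cos (2 * π / m)) +
        (S ℝ ((m - 3) / 2)).eval (2 * cos (2 * π / m))) = 0 ∧
    (S ℝ ((m - 1) / 2)).eval (2 * cos (2 * π / m)) *
      ((S ℝ (m / 2)).eval (2 * cos (2 * π / m)) +
        (S ℝ ((m - 2) / 2)).eval (2 * cos (2 * π / m))) = 0 := by
  have hsin := sin_two_pi_div_ne_zero hm
  have hm0 : (m : ℝ) ≠ 0 := by positivity
  set θ := 2 * π / m with hθ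
  have hmθ : m * θ = 2 * π := by rw [hθ]; field_simp
  obtain ⟨k, rfl | rfl⟩ := Nat.even_or_odd' m
  · have h0 : (S ℝ (k - 1)).eval (2 * cos θ) = 0 := by
      refine (mul_eq_zero.mp ?_).resolve_right hsin
      rw [S_two_mul_real_cos]
      push_cast at hmθ ⊢
      rw [show ((k : ℝ) - 1 + 1) * θ = π by linarith, sin_pi]
    rw [show (((2 * k : ℕ) : ℤ) - 2) / 2 = k - 1 by lia,
      show (((2 * k : ℕ) : ℤ) - 1) / 2 = k - 1 by lia, h0]
    simp
  · have h0 : (S ℝ k).eval (2 * cos θ) + (S ℝ (k - 1)).eval (2 * cos θ) = 0 := by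
      refine (mul_eq_zero.mp ?_).resolve_right hsin
      rw [add_mul, S_two_mul_real_cos, S_two_mul_real_cos]
      push_cast at hmθ ⊢
      rw [show ((k : ℝ) + 1) * θ = 2 * π - k * θ by linarith, sin_two_pi_sub, sub_add_cancel]
      ring
    rw [show (((2 * k + 1 : ℕ) : ℤ) - 2) / 2 = k - 1 by lia,
      show (((2 * k + 1 : ℕ) : ℤ) - 1) / 2 = k by lia,
      show (((2 * k + 1 : ℕ) : ℤ) - 3) / 2 = k - 1 by lia,
      show ((2 * k + 1 : ℕ) : ℤ) / 2 = k by lia, h0]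
    simp

theorem isIntegral_two_mul_cos_pi_div (m : ℕ) : IsIntegral ℤ (2 * cos (π / m)) := by
  have h := isIntegral_two_mul_cos_rat_mul_pi (1 / m)
  push_cast at h
  rwa [one_div_mul_eq_div] at h

end Trigonometry

section Representation

open Polynomial.Chebyshev Real

variable {B : Type*} [Fintype B] [DecidableEq B]

/-- The reflection `v ↦ v - (C v)ₛ eₛ` of `B → R` attached to a matrix `C` with `Cₛₛ = 2`. -/
def Matrix.coordReflection {R : Type*} [CommRing R] (C : Matrix B B R) (hC2 : ∀ s, C s s = 2)
    (s : B) : (B → R) ≃ₗ[R] (B → R) :=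
  Module.reflection (x := Pi.single s 1) (f := LinearMap.proj s ∘ₗ C.mulVecLin)
    (by simp [hC2])

theorem Matrix.coordReflection_apply {R : Type*} [CommRing R] (C : Matrix B B R)
    (hC2 : ∀ s, C s s = 2) (s : B) (v : B → R) :
    C.coordReflection hC2 s v = v - (C.mulVec v) s • Pi.single s 1 := by
  simp [coordReflection, Module.reflection_apply]

theorem CoxeterMatrix.isLiftable_coordReflection (M : CoxeterMatrix B) {R : Type*} [CommRing R]
    [Algebra R ℝ] [FaithfulSMul R ℝ] (C : Matrix B B R) (hC2 : ∀ s, C s s = 2)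
    (hC : ∀ s t, algebraMap R ℝ (C s t) = -(2 * cos (π / M s t))) :
    M.IsLiftable (C.coordReflection hC2) := by
  have hinj : Function.Injective (algebraMap R ℝ) := FaithfulSMul.algebraMap_injective R ℝ
  intro s t
  rcases eq_or_ne s t with rfl | hst
  · rw [M.diagonal, pow_one]
    exact LinearEquiv.ext fun v ↦ Module.involutive_reflection _ v
  have hts : C t s = C s t := hinj (by rw [hC, hC, M.symmetric])
  rcases Nat.lt_or_ge (M s t) 3 with h3 | h3
  · have h1 := M.off_diagonal s t hst
    obtain h0 | h2 : M s t = 0 ∨ M s t = 2 := by lia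
    · rw [h0, pow_zero]
    · have h0 : C s t = 0 := hinj (by rw [hC, h2]; simp)
      ext1 v
      simp only [h2, pow_two, LinearEquiv.mul_apply, Matrix.coordReflection_apply, Matrix.mulVec_sub,
        Matrix.mulVec_smul, Matrix.mulVec_single_one, Pi.sub_apply, Pi.smul_apply,
        Matrix.col_apply, hC2, h0, hts, smul_eq_mul, LinearEquiv.coe_one, id_eq]
      module
  · have ht : algebraMap R ℝ (C s t * C t s - 2) = 2 * cos (2 * π / M s t) := by
      rw [hts, map_sub, map_mul, hC, mul_div_assoc, cos_two_mul, map_ofNat]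
      ring
    obtain ⟨e1, e2⟩ := S_eval_two_mul_cos_mul_eq_zero h3
    simp only [← ht, ← algebraMap_eval_S, ← map_add, ← map_mul] at e1 e2
    rw [map_eq_zero_iff _ hinj] at e1 e2
    ext1 v
    rw [Matrix.coordReflection, Matrix.coordReflection,
      Module.reflection_mul_reflection_pow_apply _ _ _ _ (C s t * C t s - 2) (by simp), e1, e2]
    simp

/-- Coxeter groups of finite rank embed into integral matrix groups. -/
theorem CoxeterSystem.exists_injective_matrix {M : CoxeterMatrix B} {W : Type*} [Group W]
    (cs : CoxeterSystem M W) :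
    ∃ (n : ℕ) (φ : W →* Matrix (Fin n) (Fin n) ℤ), Function.Injective φ := by
  let A := Algebra.adjoin ℤ (Set.range fun p : B × B ↦ 2 * cos (π / M p.1 p.2))
  have : Module.Finite ℤ A := Algebra.finite_adjoin_of_finite_of_isIntegral (Set.finite_range _)
    (by rintro _ ⟨p, rfl⟩; exact isIntegral_two_mul_cos_pi_div _)
  let C : Matrix B B A := fun s t ↦ -⟨2 * cos (π / M s t), Algebra.subset_adjoin ⟨(s, t), rfl⟩⟩
  have hCval (s t : B) : algebraMap A ℝ (C s t) = -(2 * cos (π / M s t)) := rfl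
  have hC2 (s : B) : C s s = 2 := Subtype.ext <| (hCval s s).trans (by simp; rfl)
  have hC (s t : B) : C s t = C t s :=
    Subtype.ext <| (hCval s t).trans (by rw [M.symmetric]; exact (hCval t s).symm)
  have hpos (s t : B) (k : ℕ) (h : M s t = 0 ∨ k < M s t) : 0 ≤ (S A k).eval (-C s t) := by
    rw [← Subtype.coe_le_coe]
    change (0 : ℝ) ≤ algebraMap A ℝ _
    rw [algebraMap_eval_S, map_neg, hCval, neg_neg]
    exact S_eval_two_mul_cos_pi_div_nonneg h
  let ρ := cs.lift ⟨_, M.isLiftable_coordReflection C hC2 hCval⟩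
  have hρ (s : B) (v : B → A) :
      ρ (cs.simple s) v = v - (C.mulVec v) s • Pi.single s 1 := by
    rw [cs.lift_apply_simple, C.coordReflection_apply]
  have hinj := injective_of_apply_simple cs hρ hC2 hC hpos
  let b := Module.finBasis ℤ (B → A)
  let res : ((B → A) ≃ₗ[A] (B → A)) →* Module.End ℤ (B → A) :=
    { toFun g := g.toLinearMap.restrictScalars ℤ
      map_one' := rfl
      map_mul' _ _ := rfl }
  refine ⟨_, ((LinearMap.toMatrixAlgEquiv b).toMulEquiv.toMonoidHom.comp res).comp ρ, ?_⟩
  refine (LinearMap.toMatrixAlgEquiv b).injective.comp (Function.Injective.comp ?_ hinj)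
  exact fun g h hgh ↦ LinearEquiv.ext fun v ↦ LinearMap.congr_fun hgh v

end Representation

/-- Every torsion subgroup of a Coxeter group with finitely many simple reflections
is finite. -/
theorem coxeter_torsion_subgroup_finite {B : Type*} [Finite B] (M : CoxeterMatrix B)
    {W : Type*} [Group W] (cs : CoxeterSystem M W)
    (T : Subgroup W) (hT : ∀ x ∈ T, IsOfFinOrder x) :
    (T : Set W).Finite := by
  classical
  have := Fintype.ofFinite B
  obtain ⟨n, φ, hφ⟩ := cs.exists_injective_matrix
  exact T.finite_of_torsion_of_injective_matrix φ hφ hT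
end

section
/- Let W be a Coxeter group with a finite generating set, i.e. the group of a Coxeter system (W, S) with S finite. Then every abelian subgroup of W is finitely generated. -/
/-- Finite generation of unit groups passes to subrings. -/
theorem isNoetherian_additive_units_of_injective {R S : Type*} [CommRing R] [CommRing S]
    [IsNoetherian ℤ (Additive Sˣ)] (f : R →+* S) (hf : Function.Injective f) :
    IsNoetherian ℤ (Additive Rˣ) :=
  isNoetherian_of_injective (Units.map (f : R →* S)).toAdditive.toIntLinearMap
    (Units.map_injective hf)

/-- If the kernels of two ring homomorphisms have zero product, then the units of the source are
controlled by the units of the targets and the additive group of the source. -/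
theorem isNoetherian_additive_units_of_ker_mul_ker_eq_bot {R S T : Type*} [CommRing R] [CommRing S]
    [CommRing T] [IsNoetherian ℤ R] (f : R →+* S) (g : R →+* T)
    (hfg : RingHom.ker f * RingHom.ker g = ⊥)
    [IsNoetherian ℤ (Additive Sˣ)] [IsNoetherian ℤ (Additive Tˣ)] :
    IsNoetherian ℤ (Additive Rˣ) := by
  let φ : Additive Rˣ →ₗ[ℤ] Additive Sˣ × Additive Tˣ :=
    (Units.map (f : R →* S)).toAdditive.toIntLinearMap.prod
      (Units.map (g : R →* T)).toAdditive.toIntLinearMap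
  have hker (u : LinearMap.ker φ) :
      (u.1.toMul : R) - 1 ∈ RingHom.ker f ∧ (u.1.toMul : R) - 1 ∈ RingHom.ker g := by
    have hu : φ u.1 = 0 := u.2
    obtain ⟨h₁, h₂⟩ := Prod.ext_iff.1 hu
    have h₁' : f (u.1.toMul : R) = 1 := congrArg (fun x : Additive Sˣ ↦ (x.toMul : S)) h₁
    have h₂' : g (u.1.toMul : R) = 1 := congrArg (fun x : Additive Tˣ ↦ (x.toMul : T)) h₂
    simp [RingHom.mem_ker, h₁', h₂']
  let ψ : LinearMap.ker φ →+ R := AddMonoidHom.mk' (fun u ↦ (u.1.toMul : R) - 1) <| by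
    intro u v
    have h : ((u.1.toMul : R) - 1) * ((v.1.toMul : R) - 1) = 0 := by
      rw [← Ideal.mem_bot, ← hfg]
      exact Ideal.mul_mem_mul (hker u).1 (hker v).2
    simp only [Submodule.coe_add, toMul_add, Units.val_mul]
    linear_combination h
  have hψ : Function.Injective ψ.toIntLinearMap := by
    intro u v huv
    have : (u.1.toMul : R) - 1 = (v.1.toMul : R) - 1 := huv
    exact Subtype.ext (Additive.toMul.injective (Units.ext (sub_left_injective this)))
  have := isNoetherian_of_injective ψ.toIntLinearMap hψ
  exact isNoetherian_of_range_eq_ker (LinearMap.ker φ).subtype φ (by simp)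

/-- The fraction field of a domain of characteristic zero that is finite over `ℤ` is a number
field. -/
theorem numberField_of_finite_int (R K : Type*) [CommRing R] [Field K] [CharZero K]
    [Module.Finite ℤ R] [Algebra R K] [IsFractionRing R K] : NumberField K := by
  obtain ⟨s, hs⟩ := Module.Finite.fg_top (R := ℤ) (M := R)
  have hint (r : R) : IsIntegral ℤ (algebraMap R K r) :=
    (Algebra.IsIntegral.isIntegral (R := ℤ) r).map (algebraMap R K).toIntAlgHom
  let F := IntermediateField.adjoin ℚ (algebraMap R K '' (s : Set R))
  have hfin : FiniteDimensional ℚ F := by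
    have := (s.finite_toSet.image (algebraMap R K)).to_subtype
    refine IntermediateField.finiteDimensional_adjoin ?_
    rintro _ ⟨r, -, rfl⟩
    exact (hint r).tower_top
  have hmem (r : R) : algebraMap R K r ∈ F := by
    have hr : r ∈ Submodule.span ℤ (s : Set R) := hs ▸ Submodule.mem_top
    induction hr using Submodule.span_induction with
    | mem x hx => exact IntermediateField.subset_adjoin _ _ ⟨x, hx, rfl⟩
    | zero => simp
    | add x y _ _ hx hy => simpa using add_mem hx hy
    | smul n x _ hx => simpa using zsmul_mem hx n
  have htop : F = ⊤ := by
    refine eq_top_iff.2 fun x _ ↦ ?_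
    obtain ⟨a, b, -, rfl⟩ := IsFractionRing.div_surjective (A := R) x
    exact div_mem (hmem a) (hmem b)
  rw [htop] at hfin
  have : FiniteDimensional ℚ K :=
    Module.Finite.equiv (IntermediateField.topEquiv (F := ℚ) (E := K)).toLinearEquiv
  constructor

/-- The unit group of a domain of characteristic zero that is finite over `ℤ` is finitely generated,
by Dirichlet's unit theorem. -/
theorem isNoetherian_additive_units_of_isFractionRing (R K : Type*) [CommRing R] [CharZero R]
    [Field K] [Module.Finite ℤ R] [Algebra R K] [IsFractionRing R K] :
    IsNoetherian ℤ (Additive Rˣ) := by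
  have : CharZero K := charZero_of_injective_algebraMap (IsFractionRing.injective R K)
  have := numberField_of_finite_int R K
  let ι : R →+* NumberField.RingOfIntegers K :=
    (algebraMap R K).codRestrict (integralClosure ℤ K) fun r ↦
      (Algebra.IsIntegral.isIntegral (R := ℤ) r).map (algebraMap R K).toIntAlgHom
  have hι : Function.Injective ι := fun a b h ↦
    IsFractionRing.injective R K (congrArg (algebraMap (NumberField.RingOfIntegers K) K) h)
  exact isNoetherian_additive_units_of_injective ι hι

/-- The unit group of a domain that is finite over `ℤ` is finitely generated. -/
theorem isNoetherian_additive_units_of_isDomain (R : Type*) [CommRing R] [IsDomain R]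
    [Module.Finite ℤ R] : IsNoetherian ℤ (Additive Rˣ) := by
  obtain ⟨p, hp⟩ := CharP.exists R
  rcases eq_or_ne p 0 with rfl | hp0
  · have := CharP.charP_to_charZero R
    exact isNoetherian_additive_units_of_isFractionRing R (FractionRing R)
  · have : Finite R := by
      refine Module.finite_of_fg_torsion R fun x ↦ ⟨⟨(p : ℤ), ?_⟩, ?_⟩
      · simpa using hp0
      · simp [Submonoid.smul_def]
    have : Finite (Additive Rˣ) := inferInstanceAs (Finite Rˣ)
    infer_instance

/-- The unit group of a commutative ring that is finite over `ℤ` is finitely generated. -/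
theorem isNoetherian_additive_units (R : Type*) [CommRing R] [Module.Finite ℤ R] :
    IsNoetherian ℤ (Additive Rˣ) := by
  have : IsNoetherianRing R := isNoetherian_of_tower ℤ inferInstance
  suffices h : ∀ I : Ideal R, IsNoetherian ℤ (Additive (R ⧸ I)ˣ) by
    have := h ⊥
    exact isNoetherian_additive_units_of_injective (RingEquiv.quotientBot R).symm.toRingHom
      (RingEquiv.quotientBot R).symm.injective
  intro I
  induction I using WellFoundedGT.induction with
  | ind I ih =>
  have : Module.Finite ℤ (R ⧸ I) :=
    Module.Finite.of_surjective (Ideal.Quotient.mk I).toIntAlgHom.toLinearMap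
      Ideal.Quotient.mk_surjective
  by_cases hI : I.IsPrime
  · exact isNoetherian_additive_units_of_isDomain _
  rcases eq_or_ne I ⊤ with rfl | hI'
  · have : Finite (Additive (R ⧸ (⊤ : Ideal R))ˣ) :=
      inferInstanceAs (Finite (R ⧸ (⊤ : Ideal R))ˣ)
    infer_instance
  obtain ⟨a, ha, b, hb, hab⟩ := (Ideal.not_isPrime_iff.1 hI).resolve_left hI'
  have key (x) (hx : x ∉ I) : I < I ⊔ Ideal.span {x} :=
    left_lt_sup.2 (by simpa [Ideal.span_singleton_le_iff_mem])
  have := ih _ (key a ha)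
  have := ih _ (key b hb)
  have : IsNoetherian ℤ (R ⧸ I) := inferInstance
  refine isNoetherian_additive_units_of_ker_mul_ker_eq_bot
    (Ideal.Quotient.factor (key a ha).le) (Ideal.Quotient.factor (key b hb).le) ?_
  rw [Ideal.Quotient.factor_ker, Ideal.Quotient.factor_ker, ← Ideal.map_mul,
    Ideal.map_eq_bot_iff_le_ker, Ideal.mk_ker, Ideal.sup_mul, Ideal.mul_sup]
  refine sup_le (sup_le Ideal.mul_le_left Ideal.mul_le_left) ?_
  rw [Ideal.mul_sup, Ideal.span_singleton_mul_span_singleton]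
  exact sup_le Ideal.mul_le_right (by simpa [Ideal.span_singleton_le_iff_mem])

open scoped IsMulCommutative in
/-- An abelian subgroup of a group embedding into the units of a ring that is finite over `ℤ` is
finitely generated. -/
theorem Subgroup.fg_of_injective_monoidHom_of_finite_int {G E : Type*} [Group G] [Ring E]
    [Module.Finite ℤ E] (ρ : G →* E) (hρ : Function.Injective ρ) (A : Subgroup G)
    (hA : ∀ x ∈ A, ∀ y ∈ A, x * y = y * x) : A.FG := by
  let C := Algebra.adjoin ℤ (ρ '' A)
  have : IsMulCommutative C := Algebra.isMulCommutative_adjoin ℤ <| by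
    rintro _ ⟨x, hx, rfl⟩ _ ⟨y, hy, rfl⟩
    rw [← map_mul, hA x hx y hy, map_mul]
  have : IsNoetherian ℤ E := inferInstance
  have : Module.Finite ℤ C :=
    Module.Finite.of_injective C.val.toLinearMap Subtype.val_injective
  let σ : A →* C := (ρ.comp A.subtype).codRestrict C fun a ↦
    Algebra.subset_adjoin ⟨a, a.2, rfl⟩
  have hσ : Function.Injective σ.toHomUnits := fun a b h ↦
    Subtype.ext (hρ (congrArg (fun u : Cˣ ↦ ((u : C) : E)) h))
  have hnoeth := isNoetherian_additive_units C
  have hrange : Group.FG σ.toHomUnits.range := by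
    rw [Group.fg_iff_subgroup_fg, Subgroup.fg_iff_add_fg]
    exact (Submodule.fg_iff_addSubgroup_fg _).1
      (hnoeth.noetherian (AddSubgroup.toIntSubmodule (Subgroup.toAddSubgroup σ.toHomUnits.range)))
  rw [← Group.fg_iff_subgroup_fg]
  exact Group.fg_of_surjective (f := (MonoidHom.ofInjective hσ).symm.toMonoidHom)
    (MonoidHom.ofInjective hσ).symm.surjective

namespace CoxeterMatrix

open Module Polynomial.Chebyshev

variable {B : Type*} (M : CoxeterMatrix B)

/-- The ring generated by the numbers `2 * cos (π / M i j)`, over which the geometric representation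
is defined. Here `π / 0 = 0`, so that an infinite label contributes `2`. -/
noncomputable def cosSubring : Subalgebra ℤ ℝ :=
  Algebra.adjoin ℤ (Set.range fun p : B × B ↦ 2 * Real.cos (Real.pi / M p.1 p.2))

/-- The number `2 * cos (π / M i j)`, as an element of `cosSubring`. -/
noncomputable def twoCos (i j : B) : M.cosSubring :=
  ⟨2 * Real.cos (Real.pi / M i j), Algebra.subset_adjoin ⟨(i, j), rfl⟩⟩

theorem coe_twoCos (i j : B) : (M.twoCos i j : ℝ) = 2 * Real.cos (Real.pi / M i j) := rfl

theorem twoCos_comm (i j : B) : M.twoCos i j = M.twoCos j i := by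
  simp only [twoCos, M.symmetric i j]

theorem twoCos_self (i : B) : M.twoCos i i = -2 :=
  Subtype.ext <| by
    have h2 : ((2 : M.cosSubring) : ℝ) = 2 := rfl
    simp [coe_twoCos, h2]

theorem two_le_of_ne {i j : B} (hij : i ≠ j) (h0 : M i j ≠ 0) : 2 ≤ M i j := by
  have := M.off_diagonal i j hij
  lia

theorem twoCos_nonneg {i j : B} (hij : i ≠ j) : 0 ≤ M.twoCos i j := by
  rw [← Subtype.coe_le_coe, coe_twoCos]
  rcases eq_or_ne (M i j) 0 with h0 | h0
  · simp [h0]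
  · have h2 : (2 : ℝ) ≤ M i j := mod_cast M.two_le_of_ne hij h0
    have : Real.pi / M i j ≤ Real.pi / 2 := by gcongr
    have := Real.cos_nonneg_of_neg_pi_div_two_le_of_le
      (by linarith [Real.pi_pos, show 0 ≤ Real.pi / M i j by positivity]) this
    simpa using this

instance [Finite B] : Module.Finite ℤ M.cosSubring := by
  refine Algebra.finite_adjoin_of_finite_of_isIntegral (Set.finite_range _) ?_
  rintro _ ⟨p, rfl⟩
  convert! Real.isIntegral_two_mul_cos_rat_mul_pi (1 / M p.1 p.2) using 3
  push_cast
  ring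

/-- The coroot attached to a simple reflection, a functional on the root space `B →₀ cosSubring`. -/
noncomputable def simpleCoroot (i : B) : Dual M.cosSubring (B →₀ M.cosSubring) :=
  Finsupp.linearCombination M.cosSubring fun j ↦ -M.twoCos i j

/-- The simple root attached to a simple reflection. -/
noncomputable def simpleRoot (i : B) : B →₀ M.cosSubring := Finsupp.single i 1

theorem simpleCoroot_simpleRoot (i j : B) :
    M.simpleCoroot i (M.simpleRoot j) = -M.twoCos i j := by
  simp [simpleCoroot, simpleRoot]

theorem simpleCoroot_simpleRoot_self (i : B) : M.simpleCoroot i (M.simpleRoot i) = 2 := by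
  simp [simpleCoroot_simpleRoot, twoCos_self]

theorem simpleRoot_nonneg (i : B) : 0 ≤ M.simpleRoot i :=
  Finsupp.single_nonneg.2 zero_le_one

/-- The reflection by which a simple reflection acts in the geometric representation. -/
noncomputable def geometricReflection (i : B) :
    (B →₀ M.cosSubring) ≃ₗ[M.cosSubring] (B →₀ M.cosSubring) :=
  reflection (M.simpleCoroot_simpleRoot_self i)

/-- The trace parameter of the rotation `s i * s j`, equal to `2 * cos (2 * π / M i j)`. -/
noncomputable def rotationTrace (i j : B) : M.cosSubring :=
  M.simpleCoroot i (M.simpleRoot j) * M.simpleCoroot j (M.simpleRoot i) - 2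

theorem coe_rotationTrace (i j : B) :
    (M.rotationTrace i j : ℝ) = 2 * Real.cos (2 * (Real.pi / M i j)) := by
  simp only [rotationTrace, simpleCoroot_simpleRoot, M.twoCos_comm j i, Real.cos_two_mul]
  have h2 : ((2 : M.cosSubring) : ℝ) = 2 := rfl
  push_cast
  rw [coe_twoCos, h2]
  ring

theorem coe_eval_S_rotationTrace (i j : B) (n : ℤ) :
    (((S M.cosSubring n).eval (M.rotationTrace i j) : M.cosSubring) : ℝ) =
      (S ℝ n).eval (2 * Real.cos (2 * (Real.pi / M i j))) := by
  rw [← coe_rotationTrace, ← map_S M.cosSubring.val.toRingHom, Polynomial.eval_map]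
  exact Polynomial.hom_eval₂ _ (RingHom.id _) M.cosSubring.val.toRingHom _

theorem coe_eval_S_rotationTrace_mul_sin (i j : B) (n : ℤ) :
    (((S M.cosSubring n).eval (M.rotationTrace i j) : M.cosSubring) : ℝ) *
      Real.sin (2 * (Real.pi / M i j)) = Real.sin ((n + 1) * (2 * (Real.pi / M i j))) := by
  rw [coe_eval_S_rotationTrace, S_two_mul_real_cos]

theorem sin_rotationAngle_pos {i j : B} (h : 3 ≤ M i j) :
    0 < Real.sin (2 * (Real.pi / M i j)) := by
  have h3 : (3 : ℝ) ≤ M i j := mod_cast h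
  have : Real.pi / M i j ≤ Real.pi / 3 := by gcongr
  exact Real.sin_pos_of_pos_of_lt_pi (by positivity) (by linarith [Real.pi_pos])

theorem eval_S_rotationTrace_eq_zero {i j : B} {k : ℤ} (h : 3 ≤ M i j)
    (hk : 2 * (k + 1) = M i j) : (S M.cosSubring k).eval (M.rotationTrace i j) = 0 := by
  refine Subtype.ext ((mul_eq_zero.1 ?_).resolve_right (M.sin_rotationAngle_pos h).ne')
  rw [coe_eval_S_rotationTrace_mul_sin, ← Real.sin_pi]
  have h' : (2 * (k + 1) : ℝ) = M i j := mod_cast hk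
  have h3 : (3 : ℝ) ≤ M i j := mod_cast h
  congr 1
  field_simp
  linarith

theorem eval_S_add_eval_S_rotationTrace_mul_sin (i j : B) (k : ℤ) :
    (((S M.cosSubring k).eval (M.rotationTrace i j) +
      (S M.cosSubring (k - 1)).eval (M.rotationTrace i j) : M.cosSubring) : ℝ) *
      Real.sin (2 * (Real.pi / M i j)) =
      2 * Real.sin ((2 * k + 1) * (Real.pi / M i j)) * Real.cos (Real.pi / M i j) := by
  push_cast
  rw [add_mul, coe_eval_S_rotationTrace_mul_sin, coe_eval_S_rotationTrace_mul_sin]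
  rw [Real.two_mul_sin_mul_cos, add_comm]
  push_cast
  congr 2 <;> ring

theorem eval_S_add_eval_S_rotationTrace_eq_zero {i j : B} {k : ℤ} (h : 3 ≤ M i j)
    (hk : 2 * k + 1 = M i j) : (S M.cosSubring k).eval (M.rotationTrace i j) +
      (S M.cosSubring (k - 1)).eval (M.rotationTrace i j) = 0 := by
  refine Subtype.ext ((mul_eq_zero.1 ?_).resolve_right (M.sin_rotationAngle_pos h).ne')
  rw [eval_S_add_eval_S_rotationTrace_mul_sin]
  have h' : (2 * k + 1 : ℝ) = M i j := mod_cast hk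
  have h3 : (3 : ℝ) ≤ M i j := mod_cast h
  rw [h', mul_div_cancel₀ _ (by positivity)]
  simp

theorem geometricReflection_isLiftable : M.IsLiftable M.geometricReflection := by
  intro i j
  rcases eq_or_ne i j with rfl | hij
  · rw [M.diagonal, pow_one]
    exact LinearEquiv.ext (involutive_reflection (M.simpleCoroot_simpleRoot_self i))
  rcases eq_or_ne (M i j) 0 with h0 | h0
  · rw [h0, pow_zero]
  have h2 := M.two_le_of_ne hij h0
  refine LinearEquiv.ext fun z ↦ ?_
  rw [geometricReflection, geometricReflection, reflection_mul_reflection_pow_apply _ _ _ _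
    (M.rotationTrace i j) rfl]
  rcases h2.eq_or_lt with h2 | h3
  · have hc : M.twoCos i j = 0 := Subtype.ext <| by simp [coe_twoCos, ← h2]
    have ht : M.rotationTrace i j = -2 := by
      simp [rotationTrace, simpleCoroot_simpleRoot, hc]
    simp only [← h2, simpleCoroot_simpleRoot, M.twoCos_comm j i, hc, ht]
    norm_num
    module
  · rw [LinearEquiv.coe_one, id]
    obtain ⟨k, hk | hk⟩ := Nat.even_or_odd' (M i j)
    · have h1 : ((M i j : ℤ) - 2) / 2 = k - 1 := by lia
      have h2 : ((M i j : ℤ) - 1) / 2 = k - 1 := by lia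
      rw [h1, h2, M.eval_S_rotationTrace_eq_zero h3 (by lia)]
      simp
    · have h1 : ((M i j : ℤ) - 1) / 2 = k := by lia
      have h2 : ((M i j : ℤ) - 3) / 2 = k - 1 := by lia
      have h4 : (M i j : ℤ) / 2 = k := by lia
      have h5 : ((M i j : ℤ) - 2) / 2 = k - 1 := by lia
      rw [h1, h2, h4, h5, M.eval_S_add_eval_S_rotationTrace_eq_zero h3 (by lia)]
      simp

theorem eval_S_rotationTrace_nonneg {i j : B} (hij : i ≠ j) {k : ℕ}
    (hk : M i j ≠ 0 → 2 * k ≤ M i j) :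
    0 ≤ (S M.cosSubring (k - 1)).eval (M.rotationTrace i j) := by
  rcases Nat.eq_zero_or_pos k with rfl | hk0
  · simp
  rw [← Subtype.coe_le_coe]
  rcases eq_or_ne (M i j) 0 with h0 | h0
  · rw [coe_eval_S_rotationTrace]
    simp [h0]
  rcases (M.two_le_of_ne hij h0).eq_or_lt with h2 | h3
  · have : k = 1 := by have := hk h0; lia
    simp [this]
  refine nonneg_of_mul_nonneg_left ?_ (M.sin_rotationAngle_pos h3)
  rw [coe_eval_S_rotationTrace_mul_sin]
  have h' : (2 * k : ℝ) ≤ M i j := mod_cast hk h0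
  have hM : (0 : ℝ) < M i j := by positivity
  push_cast
  refine Real.sin_nonneg_of_nonneg_of_le_pi (by simp; positivity) ?_
  calc ((k : ℝ) - 1 + 1) * (2 * (Real.pi / M i j)) = Real.pi * ((2 * k) / M i j) := by ring
    _ ≤ Real.pi * 1 := by gcongr; exact (div_le_one hM).2 h'
    _ = Real.pi := mul_one _

theorem eval_S_add_eval_S_rotationTrace_nonneg {i j : B} (hij : i ≠ j) {k : ℕ}
    (hk : M i j ≠ 0 → 2 * k + 1 ≤ M i j) :
    0 ≤ (S M.cosSubring k).eval (M.rotationTrace i j) +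
      (S M.cosSubring (k - 1)).eval (M.rotationTrace i j) := by
  rcases Nat.eq_zero_or_pos k with rfl | hk0
  · simp
  rw [← Subtype.coe_le_coe]
  rcases eq_or_ne (M i j) 0 with h0 | h0
  · push_cast
    rw [coe_eval_S_rotationTrace, coe_eval_S_rotationTrace]
    simp [h0]
    positivity
  have h3 : 3 ≤ M i j := by have := hk h0; lia
  refine nonneg_of_mul_nonneg_left ?_ (M.sin_rotationAngle_pos h3)
  rw [eval_S_add_eval_S_rotationTrace_mul_sin]
  have hcos : (0 : ℝ) ≤ 2 * Real.cos (Real.pi / M i j) := M.twoCos_nonneg hij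
  have h' : (2 * k + 1 : ℝ) ≤ M i j := mod_cast hk h0
  have hM : (0 : ℝ) < M i j := by positivity
  rw [mul_right_comm]
  refine mul_nonneg hcos (Real.sin_nonneg_of_nonneg_of_le_pi (by positivity) ?_)
  push_cast
  calc (2 * (k : ℝ) + 1) * (Real.pi / M i j) = Real.pi * ((2 * k + 1) / M i j) := by ring
    _ ≤ Real.pi * 1 := by gcongr; exact (div_le_one hM).2 h'
    _ = Real.pi := mul_one _

end CoxeterMatrix

namespace CoxeterSystem

open Module Polynomial.Chebyshev

variable {B W : Type*} [Group W] {M : CoxeterMatrix B} (cs : CoxeterSystem M W)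

/-- The geometric representation of a Coxeter group. -/
noncomputable def geometricRep :
    W →* ((B →₀ M.cosSubring) ≃ₗ[M.cosSubring] (B →₀ M.cosSubring)) :=
  cs.lift ⟨M.geometricReflection, M.geometricReflection_isLiftable⟩

theorem geometricRep_simple (i : B) :
    cs.geometricRep (cs.simple i) = M.geometricReflection i :=
  cs.lift_apply_simple _ i

/-- A reduced alternating word not ending in `i` sends the simple root of `i` to a nonnegative
combination of two simple roots. -/
theorem exists_geometricRep_alternatingWord_apply {i j : B} (hij : i ≠ j) {n : ℕ}
    (hn : M i j ≠ 0 → n < M i j) :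
    ∃ a b : M.cosSubring, 0 ≤ a ∧ 0 ≤ b ∧
      cs.geometricRep (cs.wordProd (alternatingWord i j n)) (M.simpleRoot i) =
        a • M.simpleRoot i + b • M.simpleRoot j := by
  have hc : 0 ≤ -M.simpleCoroot j (M.simpleRoot i) := by
    simpa [CoxeterMatrix.simpleCoroot_simpleRoot] using M.twoCos_nonneg hij.symm
  rw [prod_alternatingWord_eq_mul_pow]
  obtain ⟨k, rfl | rfl⟩ := Nat.even_or_odd' n
  · refine ⟨_, _, M.eval_S_add_eval_S_rotationTrace_nonneg hij (k := k) fun h ↦ ?_,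
      mul_nonneg (M.eval_S_rotationTrace_nonneg hij (k := k) fun h ↦ ?_) hc, ?_⟩
    · have := hn h; lia
    · have := hn h; lia
    · simp only [even_two, Even.mul_right, if_true, one_mul, map_pow, map_mul,
        geometricRep_simple]
      rw [Nat.mul_div_cancel_left _ two_pos]
      exact reflection_mul_reflection_pow_apply_self _ _ k _ rfl
  · refine ⟨_, _, M.eval_S_add_eval_S_rotationTrace_nonneg hij (k := k) fun h ↦ ?_,
      mul_nonneg (M.eval_S_rotationTrace_nonneg hij (k := k + 1) fun h ↦ ?_) hc, ?_⟩
    · have := hn h; lia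
    · have := hn h; lia
    · have hodd : ¬ Even (2 * k + 1) := by simp
      have hdiv : (2 * k + 1) / 2 = k := by lia
      rw [if_neg hodd, hdiv]
      simp only [map_pow, map_mul, geometricRep_simple, Nat.cast_add, Nat.cast_one,
        add_sub_cancel_right]
      exact reflection_mul_reflection_mul_reflection_pow_apply_self _ _ k _ rfl

/-- Every element factors with additive length as an element with no right descent in `{i, j}`
followed by an alternating word in `i` and `j`. -/
theorem exists_eq_mul_alternatingWord (w : W) (i j : B) :
    ∃ (v : W) (n : ℕ), ¬ cs.IsRightDescent v i ∧ ¬ cs.IsRightDescent v j ∧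
      cs.length w = cs.length v + n ∧
      (w = v * cs.wordProd (alternatingWord i j n) ∨
        w = v * cs.wordProd (alternatingWord j i n)) := by
  induction h : cs.length w using Nat.strong_induction_on generalizing w i j with
  | _ l ih =>
  subst h
  have step (i j : B) (hj : cs.IsRightDescent w j) :
      ∃ (v : W) (n : ℕ), ¬ cs.IsRightDescent v i ∧ ¬ cs.IsRightDescent v j ∧
        cs.length w = cs.length v + n ∧ w = v * cs.wordProd (alternatingWord i j n) := by
    obtain ⟨v, n, hvi, hvj, hlen, hw⟩ := ih _ hj _ i j rfl
    have hlen' := cs.isRightDescent_iff.1 hj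
    have hswap (h : w * cs.simple j = v * cs.wordProd (alternatingWord j i n)) :
        w = v * cs.wordProd (alternatingWord i j (n + 1)) := by
      rw [alternatingWord_succ, wordProd_concat, ← mul_assoc, ← h,
        simple_mul_simple_cancel_right]
    rcases hw with hw | hw
    · cases n with
      | zero => exact ⟨v, 1, hvi, hvj, by lia, hswap (by simpa [alternatingWord] using hw)⟩
      | succ n =>
        rw [alternatingWord_succ, wordProd_concat, ← mul_assoc, mul_left_inj] at hw
        have h₁ := cs.length_mul_le v (cs.wordProd (alternatingWord j i n))
        have h₂ := cs.length_wordProd_le (alternatingWord j i n)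
        rw [length_alternatingWord] at h₂
        rw [← hw] at h₁
        lia
    · exact ⟨v, n + 1, hvi, hvj, by lia, hswap hw⟩
  by_cases hj : cs.IsRightDescent w j
  · obtain ⟨v, n, hvi, hvj, hlen, hw⟩ := step i j hj
    exact ⟨v, n, hvi, hvj, hlen, .inl hw⟩
  by_cases hi : cs.IsRightDescent w i
  · obtain ⟨v, n, hvj, hvi, hlen, hw⟩ := step j i hi
    exact ⟨v, n, hvi, hvj, hlen, .inr hw⟩
  exact ⟨w, 0, hi, hj, rfl, .inl (by simp [alternatingWord])⟩

theorem isRightDescent_of_eq_mul_alternatingWord {w v : W} {i j : B} {n : ℕ} (hn : n ≠ 0)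
    (hlen : cs.length w = cs.length v + n)
    (hw : w = v * cs.wordProd (alternatingWord j i n)) : cs.IsRightDescent w i := by
  obtain ⟨n, rfl⟩ := Nat.exists_eq_succ_of_ne_zero hn
  rw [Nat.succ_eq_add_one, alternatingWord_succ, wordProd_concat, ← mul_assoc] at hw
  rw [IsRightDescent, hw, simple_mul_simple_cancel_right, ← hw]
  have h₁ := cs.length_mul_le v (cs.wordProd (alternatingWord i j n))
  have h₂ := cs.length_wordProd_le (alternatingWord i j n)
  rw [length_alternatingWord] at h₂
  lia

/-- An element sends to a nonnegative vector each simple root that is not a right descent. -/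
theorem geometricRep_simpleRoot_nonneg {w : W} {i : B} (hwi : ¬ cs.IsRightDescent w i) :
    0 ≤ cs.geometricRep w (M.simpleRoot i) := by
  induction h : cs.length w using Nat.strong_induction_on generalizing w i with
  | _ l ih =>
  subst h
  rcases eq_or_ne w 1 with rfl | hw1
  · simpa using M.simpleRoot_nonneg i
  obtain ⟨j, hj⟩ := cs.exists_rightDescent_of_ne_one hw1
  have hij : i ≠ j := by rintro rfl; exact hwi hj
  obtain ⟨v, n, hvi, hvj, hlen, hw⟩ := cs.exists_eq_mul_alternatingWord w i j
  have hn : n ≠ 0 := by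
    rintro rfl
    have : w = v := by simpa [alternatingWord] using hw
    exact hvj (this ▸ hj)
  replace hw := hw.resolve_right fun hw ↦
    hwi (cs.isRightDescent_of_eq_mul_alternatingWord hn hlen hw)
  have hnM (h0 : M i j ≠ 0) : n < M i j := by
    by_contra! hle
    rcases hle.eq_or_lt with rfl | hlt
    · have hbraid := cs.wordProd_braidWord_eq i j
      rw [braidWord, braidWord, M.symmetric j i] at hbraid
      exact hwi (cs.isRightDescent_of_eq_mul_alternatingWord hn hlen (hbraid ▸ hw))
    · refine cs.not_isReduced_alternatingWord i j h0 hlt ?_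
      have h₁ := cs.length_mul_le v (cs.wordProd (alternatingWord i j n))
      have h₂ := cs.length_wordProd_le (alternatingWord i j n)
      rw [IsReduced]
      rw [length_alternatingWord] at h₂ ⊢
      rw [← hw] at h₁
      lia
  obtain ⟨a, b, ha, hb, hab⟩ := cs.exists_geometricRep_alternatingWord_apply hij hnM
  rw [hw, map_mul, LinearEquiv.mul_apply, hab, map_add, map_smul, map_smul]
  exact add_nonneg (smul_nonneg ha (ih _ (by lia) hvi rfl))
    (smul_nonneg hb (ih _ (by lia) hvj rfl))

theorem geometricRep_injective : Function.Injective cs.geometricRep := by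
  rw [injective_iff_map_eq_one]
  intro w hw
  by_contra hw1
  obtain ⟨i, hi⟩ := cs.exists_rightDescent_of_ne_one hw1
  have h := cs.geometricRep_simpleRoot_nonneg (cs.isRightDescent_iff_not_isRightDescent_mul.1 hi)
  rw [map_mul, hw, one_mul, geometricRep_simple, CoxeterMatrix.geometricReflection,
    reflection_apply_self] at h
  have := h i
  simp [CoxeterMatrix.simpleRoot] at this
  exact absurd this (by norm_num)

end CoxeterSystem

/-- Every abelian subgroup of a Coxeter group with finitely many simple reflections is
finitely generated. -/
theorem coxeter_abelian_subgroup_fg {B : Type*} [Finite B] (M : CoxeterMatrix B)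
    {W : Type*} [Group W] (cs : CoxeterSystem M W)
    (A : Subgroup W) (hA : ∀ x ∈ A, ∀ y ∈ A, x * y = y * x) :
    A.FG := by
  have : Module.Finite ℤ (Module.End M.cosSubring (B →₀ M.cosSubring)) :=
    Module.Finite.trans M.cosSubring _
  let ρ : W →* Module.End M.cosSubring (B →₀ M.cosSubring) :=
    LinearEquiv.automorphismGroup.toLinearMapMonoidHom.comp cs.geometricRep
  have hρ : Function.Injective ρ := fun x y h ↦
    cs.geometricRep_injective (LinearEquiv.toLinearMap_injective h)
  exact Subgroup.fg_of_injective_monoidHom_of_finite_int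
    (E := Module.End M.cosSubring (B →₀ M.cosSubring)) ρ hρ A hA
end
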